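/- Let $X \subset \mathbb{R}^n$ be a compact set and suppose $a_k \in C_c^\infty(X)$ and $\Phi_k \in C^\infty(X; \mathbb{C})$ with $\mathrm{Im}\,\Phi_k \geq 0$, both families satisfying symbol estimates $|\partial^\beta a_k| \leq C_\beta k^{|\beta|/3}$ and $|\partial^\beta \Phi_k| \leq C_\beta$ uniformly in $k$. If there exist $C, \varepsilon > 0$ such that $|\partial \Phi_k(x)| \geq C k^{-1/2 + \varepsilon}$ for all $x$ in the support of $a_k$ and all $k$, then for every $N \in \mathbb{N}$ there is $C_N$ with $\left|\int_X e^{ik\Phi_k(x)} a_k(x)\, dx\right| \leq C_N k^{-N}$ for all $k \geq 1$. -/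

import Mathlib

/-- weighted symbol class used in the proof -/
structure NSym {E : Type*} [NormedAddCommGroup E] [NormedSpace ℝ E]
    (U S : ℝ → Set E) (l : ℝ → ℝ) (W : ℝ → E → ℝ) (f : ℝ → E → ℂ) : Prop where
  smooth : ∀ k ≥ (1:ℝ), ContDiffOn ℝ (⊤:ℕ∞) (f k) (U k)
  bound : ∀ m : ℕ, ∃ C : ℝ, 0 ≤ C ∧ ∀ k ≥ (1:ℝ), ∀ x ∈ S k,
    ‖iteratedFDeriv ℝ m (f k) x‖ ≤ C * W k x * l k ^ m

section
variable {E : Type*} [NormedAddCommGroup E] [NormedSpace ℝ E]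
  {U S : ℝ → Set E} {l : ℝ → ℝ} {W V : ℝ → E → ℝ} {f h : ℝ → E → ℂ}

theorem NSym.mono (hf : NSym U S l W f) (hl : ∀ k ≥ (1:ℝ), 0 ≤ l k) (c : ℝ) (hc : 0 ≤ c)
    (hWV : ∀ k ≥ (1:ℝ), ∀ x ∈ S k, W k x ≤ c * V k x) : NSym U S l V f := by
  refine ⟨hf.smooth, fun m => ?_⟩
  obtain ⟨C, hC, h⟩ := hf.bound m
  refine ⟨C * c, by positivity, fun k hk x hx => (h k hk x hx).trans ?_⟩
  have := hl k hk
  have h2 := hWV k hk x hx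
  calc C * W k x * l k ^ m ≤ C * (c * V k x) * l k ^ m := by gcongr
    _ = _ := by ring

theorem NSym.mul (hU : ∀ k ≥ (1:ℝ), IsOpen (U k)) (hSU : ∀ k ≥ (1:ℝ), S k ⊆ U k)
    (hf : NSym U S l W f) (hh : NSym U S l V h) :
    NSym U S l (fun k x => W k x * V k x) (fun k x => f k x * h k x) := by
  refine ⟨fun k hk => (hf.smooth k hk).mul (hh.smooth k hk), fun m => ?_⟩
  choose C hC hCb using hf.bound
  choose D hD hDb using hh.bound
  refine ⟨∑ i ∈ Finset.range (m+1), (m.choose i : ℝ) * C i * D (m - i),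
    Finset.sum_nonneg fun i _ => by have := hC i; have := hD (m-i); positivity,
    fun k hk x hx => ?_⟩
  have hxU := hSU k hk hx
  have key := norm_iteratedFDerivWithin_mul_le (hf.smooth k hk) (hh.smooth k hk)
    (hU k hk).uniqueDiffOn hxU (n := m) (by exact_mod_cast le_top)
  rw [iteratedFDerivWithin_of_isOpen m (hU k hk) hxU] at key
  refine key.trans ?_
  rw [Finset.sum_mul, Finset.sum_mul]
  refine Finset.sum_le_sum fun i hi => ?_
  rw [iteratedFDerivWithin_of_isOpen _ (hU k hk) hxU, iteratedFDerivWithin_of_isOpen _ (hU k hk) hxU]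
  have hi' : i ≤ m := by simpa [Nat.lt_succ_iff] using hi
  have h1 := hCb i k hk x hx
  have h2 := hDb (m-i) k hk x hx
  have e : l k ^ m = l k ^ i * l k ^ (m-i) := by rw [← pow_add]; congr 1; omega
  calc _ ≤ (m.choose i : ℝ) * (C i * W k x * l k ^ i) * (D (m-i) * V k x * l k ^ (m-i)) := by
        rw [mul_assoc, mul_assoc]
        refine mul_le_mul_of_nonneg_left ?_ (by positivity)
        exact mul_le_mul h1 h2 (norm_nonneg _) ((norm_nonneg _).trans h1)
    _ = _ := by rw [e]; ring

theorem NSym.sum {ι : Type*} (s : Finset ι) {F : ι → ℝ → E → ℂ}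
    (hU : ∀ k ≥ (1:ℝ), IsOpen (U k)) (hSU : ∀ k ≥ (1:ℝ), S k ⊆ U k)
    (hf : ∀ i ∈ s, NSym U S l W (F i)) :
    NSym U S l W (fun k x => ∑ i ∈ s, F i k x) := by
  classical
  refine ⟨fun k hk => ContDiffOn.sum fun i hi => (hf i hi).smooth k hk, fun m => ?_⟩
  have : ∀ i : ι, ∃ C : ℝ, 0 ≤ C ∧ (i ∈ s → ∀ k ≥ (1:ℝ), ∀ x ∈ S k,
      ‖iteratedFDeriv ℝ m (F i k) x‖ ≤ C * W k x * l k ^ m) := by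
    intro i
    by_cases hi : i ∈ s
    · obtain ⟨C, h1, h2⟩ := (hf i hi).bound m
      exact ⟨C, h1, fun _ => h2⟩
    · exact ⟨0, le_rfl, fun h => absurd h hi⟩
  choose C hC hCb using this
  refine ⟨∑ i ∈ s, C i, Finset.sum_nonneg fun i _ => hC i, fun k hk x hx => ?_⟩
  rw [iteratedFDeriv_fun_sum_apply]
  · refine (norm_sum_le _ _).trans ?_
    rw [Finset.sum_mul, Finset.sum_mul]
    exact Finset.sum_le_sum fun i hi => hCb i hi k hk x hx
  · intro i hi
    exact (((hf i hi).smooth k hk).contDiffAt ((hU k hk).mem_nhds (hSU k hk hx))).of_le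
      (by exact_mod_cast le_top)

theorem NSym.deriv (hU : ∀ k ≥ (1:ℝ), IsOpen (U k)) (hSU : ∀ k ≥ (1:ℝ), S k ⊆ U k)
    (hf : NSym U S l W f) (v : E) :
    NSym U S l (fun k x => W k x * l k) (fun k x => fderiv ℝ (f k) x v) := by
  have hsm : ∀ k ≥ (1:ℝ), ContDiffOn ℝ (⊤:ℕ∞) (fderiv ℝ (f k)) (U k) := fun k hk =>
    (hf.smooth k hk).fderiv_of_isOpen (hU k hk) (by norm_num)
  refine ⟨fun k hk => (hsm k hk).clm_apply contDiffOn_const, fun m => ?_⟩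
  obtain ⟨C, hC, h⟩ := hf.bound (m+1)
  refine ⟨‖v‖ * C, by positivity, fun k hk x hx => ?_⟩
  have := norm_iteratedFDeriv_clm_apply_const (c := v) (n := m)
    ((hsm k hk).contDiffAt ((hU k hk).mem_nhds (hSU k hk hx))) (by exact_mod_cast le_top)
  refine this.trans ?_
  rw [norm_iteratedFDeriv_fderiv]
  calc _ ≤ ‖v‖ * (C * W k x * l k ^ (m+1)) := by gcongr; exact h k hk x hx
    _ = _ := by ring

theorem NSym.conj (hf : NSym U S l W f) :
    NSym U S l W (fun k x => (starRingEnd ℂ) (f k x)) := by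
  refine ⟨fun k hk => Complex.conjCLE.contDiff.comp_contDiffOn (hf.smooth k hk), fun m => ?_⟩
  obtain ⟨C, hC, h⟩ := hf.bound m
  refine ⟨C, hC, fun k hk x hx => ?_⟩
  have := LinearIsometryEquiv.norm_iteratedFDeriv_comp_left Complex.conjLIE (f k) x m
  exact (le_of_eq this).trans (h k hk x hx)

theorem NSym.inv (hU : ∀ k ≥ (1:ℝ), IsOpen (U k)) (hSU : ∀ k ≥ (1:ℝ), S k ⊆ U k)
    (hl : ∀ k ≥ (1:ℝ), 0 ≤ l k)
    (hf : NSym U S l W f) (hW : ∀ k ≥ (1:ℝ), ∀ x ∈ S k, 0 < W k x)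
    (hWf : ∀ k ≥ (1:ℝ), ∀ x ∈ S k, W k x ≤ ‖f k x‖)
    (h0 : ∀ k ≥ (1:ℝ), ∀ x ∈ U k, f k x ≠ 0) :
    NSym U S l (fun k x => (W k x)⁻¹) (fun k x => (f k x)⁻¹) := by
  have hsm : ∀ k ≥ (1:ℝ), ContDiffOn ℝ (⊤:ℕ∞) (fun x => (f k x)⁻¹) (U k) := fun k hk =>
    (hf.smooth k hk).inv (h0 k hk)
  refine ⟨hsm, fun m => ?_⟩
  choose C hC hCb using hf.bound
  set D : ℝ := 1 + ∑ i ∈ Finset.range (m+1), C i with hD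
  have hD1 : 1 ≤ D := by
    have : 0 ≤ ∑ i ∈ Finset.range (m+1), C i := Finset.sum_nonneg fun i _ => hC i
    linarith
  have hCD : ∀ i ≤ m, C i ≤ D := by
    intro i hi
    have := Finset.single_le_sum (f := C) (fun i _ => hC i) (Finset.mem_range.2 (Nat.lt_succ_of_le hi))
    linarith
  set T : Set ℂ := {0}ᶜ with hT
  have hTo : IsOpen T := isOpen_compl_singleton
  set K : ℝ := ∑ i ∈ Finset.range (m+1), ‖iteratedFDerivWithin ℝ i (fun z : ℂ => z⁻¹) T 1‖ with hK
  have hK0 : 0 ≤ K := Finset.sum_nonneg fun i _ => norm_nonneg _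
  refine ⟨m.factorial * K * D ^ m, by positivity, fun k hk x hx => ?_⟩
  have hxU := hSU k hk hx
  have hfx := h0 k hk x hxU
  have hlk := hl k hk
  have hWx := hW k hk x hx
  have hWfx := hWf k hk x hx
  have hat : ContDiffAt ℝ (⊤:ℕ∞) (f k) x := (hf.smooth k hk).contDiffAt ((hU k hk).mem_nhds hxU)
  have hat' : ContDiffAt ℝ (⊤:ℕ∞) (fun y => (f k y)⁻¹) x :=
    (hsm k hk).contDiffAt ((hU k hk).mem_nhds hxU)
  have key := norm_iteratedFDerivWithin_comp_le (𝕜 := ℝ) (g := fun z : ℂ => z⁻¹)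
    (f := fun y => (f k x)⁻¹ • f k y) (n := m) (s := U k) (t := T) (x := x) (N := (⊤:ℕ∞))
    (C := K) (D := D * l k)
    (contDiffOn_id.inv (fun z hz => hz)) ((hf.smooth k hk).const_smul _)
    (by exact_mod_cast le_top) hTo.uniqueDiffOn (hU k hk).uniqueDiffOn
    (fun y hy => by
      simp only [hT, Set.mem_compl_iff, Set.mem_singleton_iff, smul_eq_mul]
      exact mul_ne_zero (inv_ne_zero hfx) (h0 k hk y hy)) hxU
    (fun i hi => by
      simp only [smul_eq_mul, inv_mul_cancel₀ hfx]
      exact Finset.single_le_sum (f := fun i => ‖iteratedFDerivWithin ℝ i (fun z : ℂ => z⁻¹) T 1‖)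
        (fun i _ => norm_nonneg _) (Finset.mem_range.2 (Nat.lt_succ_of_le hi)))
    (fun i hi1 hi => by
      rw [iteratedFDerivWithin_of_isOpen _ (hU k hk) hxU]
      have : iteratedFDeriv ℝ i (fun y => (f k x)⁻¹ • f k y) x
          = (f k x)⁻¹ • iteratedFDeriv ℝ i (f k) x :=
        iteratedFDeriv_const_smul_apply' (a := (f k x)⁻¹) (hat.of_le (by exact_mod_cast le_top))
      rw [this, norm_smul, norm_inv]
      calc _ ≤ (W k x)⁻¹ * (C i * W k x * l k ^ i) := by
            gcongr
            exact hCb i k hk x hx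
        _ = C i * l k ^ i := by field_simp
        _ ≤ D * l k ^ i := by gcongr; exact hCD i hi
        _ ≤ D ^ i * l k ^ i := by gcongr; exact le_self_pow₀ hD1 (by omega)
        _ = _ := by rw [mul_pow])
  rw [iteratedFDerivWithin_of_isOpen _ (hU k hk) hxU] at key
  have e : (fun y => (f k y)⁻¹) = fun y => (f k x)⁻¹ • ((fun z : ℂ => z⁻¹) ∘ fun y => (f k x)⁻¹ • f k y) y := by
    ext y
    simp only [Function.comp, smul_eq_mul, mul_inv, inv_inv]
    rw [← mul_assoc, inv_mul_cancel₀ hfx, one_mul]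
  have hat2 : ContDiffAt ℝ m ((fun z : ℂ => z⁻¹) ∘ fun y => (f k x)⁻¹ • f k y) x := by
    refine ContDiffAt.inv (ContDiffAt.const_smul _ (hat.of_le (by exact_mod_cast le_top))) ?_
    simp [hfx]
  have e2 := iteratedFDeriv_const_smul_apply (a := (f k x)⁻¹) hat2
  show ‖iteratedFDeriv ℝ m (fun y => (f k y)⁻¹) x‖ ≤ _
  rw [e]
  refine (congrArg norm e2).le.trans ?_
  rw [norm_smul, norm_inv]
  calc _ ≤ (W k x)⁻¹ * (m.factorial * K * (D * l k) ^ m) := by gcongr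
    _ = _ := by rw [mul_pow]; ring
end

theorem nsp_opNorm {n : ℕ} (L : EuclideanSpace ℝ (Fin n) →L[ℝ] ℂ) :
    ‖L‖ ^ 2 ≤ ‖∑ j, L (EuclideanSpace.single j 1) *
      (starRingEnd ℂ) (L (EuclideanSpace.single j 1))‖ := by
  have e : ∑ j, L (EuclideanSpace.single j 1) * (starRingEnd ℂ) (L (EuclideanSpace.single j 1))
      = ((∑ j, ‖L (EuclideanSpace.single j 1)‖ ^ 2 : ℝ) : ℂ) := by
    push_cast
    refine Finset.sum_congr rfl fun j _ => ?_
    rw [Complex.mul_conj, Complex.normSq_eq_norm_sq]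
    push_cast; rfl
  set s : ℝ := ∑ j, ‖L (EuclideanSpace.single j 1)‖ ^ 2 with hs
  have hs0 : 0 ≤ s := Finset.sum_nonneg fun j _ => by positivity
  rw [e, Complex.norm_real, Real.norm_of_nonneg hs0]
  have : ‖L‖ ≤ Real.sqrt s := by
    refine L.opNorm_le_bound (Real.sqrt_nonneg _) fun v => ?_
    have hv : L v = ∑ j, v j • L (EuclideanSpace.single j 1) := by
      conv_lhs => rw [← (EuclideanSpace.basisFun (Fin n) ℝ).sum_repr v]
      simp
    rw [hv]
    refine (norm_sum_le _ _).trans ?_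
    have cs := Real.sum_mul_le_sqrt_mul_sqrt Finset.univ
      (fun j => ‖L (EuclideanSpace.single j 1)‖) (fun j => ‖v j‖)
    rw [EuclideanSpace.norm_eq]
    refine le_trans (le_of_eq ?_) cs
    refine Finset.sum_congr rfl fun j _ => ?_
    rw [norm_smul, mul_comm]
  calc ‖L‖ ^ 2 ≤ Real.sqrt s ^ 2 := by gcongr
    _ = s := Real.sq_sqrt hs0

open MeasureTheory in
theorem nsp_ibp {n : ℕ} (φ : EuclideanSpace ℝ (Fin n) → ℂ) (hφ : ContDiff ℝ (⊤:ℕ∞) φ) (c : ℂ)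
    (v : Fin n → EuclideanSpace ℝ (Fin n) → ℂ) (hv : ∀ j, ContDiff ℝ (⊤:ℕ∞) (v j))
    (hc : ∀ j, HasCompactSupport (v j)) (b : EuclideanSpace ℝ (Fin n) → ℂ)
    (hb : ∀ x, ∑ j, fderiv ℝ φ x (EuclideanSpace.single j 1) * v j x = b x) :
    ∫ x, Complex.exp (c * φ x) * ∑ j, fderiv ℝ (v j) x (EuclideanSpace.single j 1)
      = -(c * ∫ x, Complex.exp (c * φ x) * b x) := by
  have hφd : Differentiable ℝ φ := hφ.differentiable (by simp)
  have hvd : ∀ j, Differentiable ℝ (v j) := fun j => (hv j).differentiable (by simp)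
  have hE : ContDiff ℝ (⊤:ℕ∞) (fun x => Complex.exp (c * φ x)) := (contDiff_const.mul hφ).cexp
  have hEd : Differentiable ℝ (fun x => Complex.exp (c * φ x)) := hE.differentiable (by simp)
  have hdE : ∀ x w, fderiv ℝ (fun x => Complex.exp (c * φ x)) x w
      = c * (Complex.exp (c * φ x) * fderiv ℝ φ x w) := by
    intro x w
    have h1 := (((hφd x).hasFDerivAt.const_mul c).cexp).fderiv
    rw [h1]
    simp
    ring
  have c1 : ∀ w, Continuous (fun x => fderiv ℝ φ x w) := fun w =>
    (hφ.continuous_fderiv (by simp)).clm_apply continuous_const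
  have c2 : ∀ j w, Continuous (fun x => fderiv ℝ (v j) x w) := fun j w =>
    ((hv j).continuous_fderiv (by simp)).clm_apply continuous_const
  have hs2 : ∀ j w, HasCompactSupport (fun x => fderiv ℝ (v j) x w) := fun j w =>
    (hc j).fderiv_apply ℝ w
  have i1 : ∀ j w, Integrable (fun x => Complex.exp (c * φ x) * fderiv ℝ (v j) x w) :=
    fun j w => (hE.continuous.mul (c2 j w)).integrable_of_hasCompactSupport (hs2 j w).mul_left
  have i2 : ∀ j w, Integrable (fun x => fderiv ℝ (fun x => Complex.exp (c * φ x)) x w * v j x) := by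
    intro j w
    refine Continuous.integrable_of_hasCompactSupport ?_ (hc j).mul_left
    exact ((hE.continuous_fderiv (by simp)).clm_apply continuous_const).mul (hv j).continuous
  have i3 : ∀ j, Integrable (fun x => Complex.exp (c * φ x) * v j x) := fun j =>
    (hE.continuous.mul (hv j).continuous).integrable_of_hasCompactSupport (hc j).mul_left
  simp_rw [Finset.mul_sum]
  rw [integral_finsetSum _ (fun j _ => i1 j _)]
  simp_rw [fun j : Fin n => integral_mul_fderiv_eq_neg_fderiv_mul_of_integrable
    (i2 j (EuclideanSpace.single j 1)) (i1 j (EuclideanSpace.single j 1)) (i3 j)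
    (fun x _ => hEd x) (fun x _ => hvd j x)]
  rw [Finset.sum_neg_distrib, ← integral_finsetSum _ (fun j _ => i2 j _), ← integral_const_mul]
  congr 1
  refine integral_congr_ae (Filter.Eventually.of_forall fun x => ?_)
  simp only [hdE, ← hb, Finset.mul_sum]
  refine Finset.sum_congr rfl fun j _ => ?_
  ring

/-- non-stationary phase lemma for `S_{1/3}` amplitudes and phases with
gradient bounded below by `C k^{-1/2+ε}` on the support of the amplitude. -/
theorem stmt9 (n : ℕ) (X : Set (EuclideanSpace ℝ (Fin n))) (hX : IsCompact X)
    (a Φ : ℝ → EuclideanSpace ℝ (Fin n) → ℂ)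
    (ha_smooth : ∀ k : ℝ, ContDiff ℝ (⊤:ℕ∞) (a k))
    (hΦ_smooth : ∀ k : ℝ, ContDiff ℝ (⊤:ℕ∞) (Φ k))
    (hsupp : ∀ k : ℝ, tsupport (a k) ⊆ X)
    (hIm : ∀ k ≥ (1:ℝ), ∀ x, 0 ≤ (Φ k x).im)
    (ha_sym : ∀ m : ℕ, ∃ Cm : ℝ, ∀ k ≥ (1:ℝ), ∀ x,
      ‖iteratedFDeriv ℝ m (a k) x‖ ≤ Cm * k ^ ((m:ℝ)/3))
    (hΦ_sym : ∀ m : ℕ, ∃ Cm : ℝ, ∀ k ≥ (1:ℝ), ∀ x,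
      ‖iteratedFDeriv ℝ m (Φ k) x‖ ≤ Cm)
    (C ε : ℝ) (hC : 0 < C) (hε : 0 < ε)
    (hlow : ∀ k ≥ (1:ℝ), ∀ x ∈ tsupport (a k),
      C * k ^ (-(1:ℝ)/2 + ε) ≤ ‖fderiv ℝ (Φ k) x‖) :
    ∀ N : ℕ, ∃ CN : ℝ, ∀ k ≥ (1:ℝ),
      ‖∫ x in X, Complex.exp (Complex.I * (k:ℂ) * Φ k x) * a k x‖ ≤ CN * k ^ (-(N:ℝ)) := by
  classical
  intro N
  set δ : ℝ := max (1/3) (1/2 - ε) with hδ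
  have hδ1 : 1/3 ≤ δ := le_max_left _ _
  have hδ2 : 1/2 - ε ≤ δ := le_max_right _ _
  have hδ3 : δ < 1/2 := max_lt (by norm_num) (by linarith)
  let l : ℝ → ℝ := fun k => k ^ δ
  have hl1 : ∀ k ≥ (1:ℝ), 1 ≤ l k := fun k hk => Real.one_le_rpow hk (by linarith)
  have hl0 : ∀ k ≥ (1:ℝ), 0 ≤ l k := fun k hk => zero_le_one.trans (hl1 k hk)
  let p : Fin n → ℝ → EuclideanSpace ℝ (Fin n) → ℂ :=
    fun j k x => fderiv ℝ (Φ k) x (EuclideanSpace.single j 1)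
  let g : ℝ → EuclideanSpace ℝ (Fin n) → ℂ :=
    fun k x => ∑ j, p j k x * (starRingEnd ℂ) (p j k x)
  let U : ℝ → Set (EuclideanSpace ℝ (Fin n)) := fun k => {x | g k x ≠ 0}
  let S : ℝ → Set (EuclideanSpace ℝ (Fin n)) := fun k => tsupport (a k)
  let ρ : ℝ → EuclideanSpace ℝ (Fin n) → ℝ := fun k x => ‖fderiv ℝ (Φ k) x‖
  have hρg : ∀ k x, ρ k x ^ 2 ≤ ‖g k x‖ := fun k x => nsp_opNorm _
  have hρl : ∀ k ≥ (1:ℝ), ∀ x ∈ S k, C ≤ ρ k x * l k := by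
    intro k hk x hx
    have hk0 : 0 < k := by linarith
    have h1 := hlow k hk x hx
    have h2 : (1:ℝ) ≤ k ^ (-(1:ℝ)/2 + ε) * l k := by
      show (1:ℝ) ≤ k ^ (-(1:ℝ)/2 + ε) * k ^ δ
      rw [← Real.rpow_add hk0]
      exact Real.one_le_rpow hk (by linarith)
    calc C ≤ C * (k ^ (-(1:ℝ)/2 + ε) * l k) := le_mul_of_one_le_right hC.le h2
      _ = (C * k ^ (-(1:ℝ)/2 + ε)) * l k := by ring
      _ ≤ ρ k x * l k := mul_le_mul_of_nonneg_right h1 (hl0 k hk)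
  have hρ0 : ∀ k ≥ (1:ℝ), ∀ x ∈ S k, 0 < ρ k x := by
    intro k hk x hx
    by_contra hcon
    have h1 := hρl k hk x hx
    have h2 : ρ k x * l k ≤ 0 := mul_nonpos_of_nonpos_of_nonneg (not_lt.1 hcon) (hl0 k hk)
    linarith
  have hdΦ : ∀ k, ContDiff ℝ (⊤:ℕ∞) (fderiv ℝ (Φ k)) := fun k =>
    (hΦ_smooth k).fderiv_right (by norm_num)
  have hp : ∀ j k, ContDiff ℝ (⊤:ℕ∞) (p j k) := fun j k => (hdΦ k).clm_apply contDiff_const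
  have hpc : ∀ j k, ContDiff ℝ (⊤:ℕ∞) (fun x => (starRingEnd ℂ) (p j k x)) := fun j k =>
    Complex.conjCLE.contDiff.comp (hp j k)
  have hg : ∀ k, ContDiff ℝ (⊤:ℕ∞) (g k) := fun k =>
    ContDiff.sum fun j _ => (hp j k).mul (hpc j k)
  have hU : ∀ k ≥ (1:ℝ), IsOpen (U k) := fun k _ =>
    isOpen_ne_fun (hg k).continuous continuous_const
  have hSU : ∀ k ≥ (1:ℝ), S k ⊆ U k := by
    intro k hk x hx h0
    have h1 := hρg k x
    have h2 := hρ0 k hk x hx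
    rw [h0, norm_zero] at h1
    have : 0 < ρ k x ^ 2 := by positivity
    linarith
  have hpS : ∀ j, NSym U S l ρ (p j) := by
    intro j
    refine ⟨fun k _ => (hp j k).contDiffOn, fun m => ?_⟩
    have hej : ‖(EuclideanSpace.single j (1:ℝ) : EuclideanSpace ℝ (Fin n))‖ = 1 := by simp
    rcases Nat.eq_zero_or_pos m with rfl | hm
    · refine ⟨1, zero_le_one, fun k hk x hx => ?_⟩
      rw [norm_iteratedFDeriv_zero, pow_zero, mul_one, one_mul]
      have := (fderiv ℝ (Φ k) x).le_opNorm (EuclideanSpace.single j (1:ℝ))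
      rwa [hej, mul_one] at this
    · obtain ⟨D, hD⟩ := hΦ_sym (m+1)
      refine ⟨|D| * C⁻¹, by positivity, fun k hk x hx => ?_⟩
      have h1 := norm_iteratedFDeriv_clm_apply_const
        (c := (EuclideanSpace.single j (1:ℝ) : EuclideanSpace ℝ (Fin n))) (n := m)
        ((hdΦ k).contDiffAt (x := x)) (by exact_mod_cast le_top)
      rw [hej, one_mul, norm_iteratedFDeriv_fderiv] at h1
      have h2 := hρl k hk x hx
      have h3 : l k ≤ l k ^ m := le_self_pow₀ (hl1 k hk) (by omega)
      have h4 := hρ0 k hk x hx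
      calc _ ≤ D := h1.trans (hD k hk x)
        _ ≤ |D| := le_abs_self D
        _ = |D| * C⁻¹ * C := by field_simp
        _ ≤ |D| * C⁻¹ * (ρ k x * l k ^ m) := by
          have : C ≤ ρ k x * l k ^ m := h2.trans (by gcongr)
          gcongr
        _ = _ := by ring
  have hgS : NSym U S l (fun k x => ρ k x ^ 2) g := by
    refine NSym.sum _ hU hSU fun j _ => ?_
    refine (NSym.mul hU hSU (hpS j) (hpS j).conj).mono hl0 1 zero_le_one fun k _ x _ => ?_
    exact le_of_eq (by ring)
  have hgi : NSym U S l (fun k x => (ρ k x ^ 2)⁻¹) (fun k x => (g k x)⁻¹) :=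
    hgS.inv hU hSU hl0 (fun k hk x hx => pow_pos (hρ0 k hk x hx) 2) (fun k _ x _ => hρg k x)
      (fun k _ x hx => hx)
  let u : Fin n → ℝ → EuclideanSpace ℝ (Fin n) → ℂ :=
    fun j k x => (starRingEnd ℂ) (p j k x) * (g k x)⁻¹
  have huS : ∀ j, NSym U S l (fun k _ => l k) (u j) := by
    intro j
    refine (NSym.mul hU hSU (hpS j).conj hgi).mono hl0 C⁻¹ (by positivity) fun k hk x hx => ?_
    have h2 := hρl k hk x hx
    have h4 := hρ0 k hk x hx
    rw [inv_mul_eq_div, le_div_iff₀ hC]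
    calc ρ k x * (ρ k x ^ 2)⁻¹ * C ≤ ρ k x * (ρ k x ^ 2)⁻¹ * (ρ k x * l k) := by gcongr
      _ = l k := by field_simp
  have hpu : ∀ k x, x ∈ U k → ∑ j, p j k x * u j k x = 1 := by
    intro k x hx
    have : ∑ j, p j k x * u j k x = g k x * (g k x)⁻¹ := by
      show _ = (∑ j, p j k x * (starRingEnd ℂ) (p j k x)) * (g k x)⁻¹
      rw [Finset.sum_mul]
      exact Finset.sum_congr rfl fun j _ => by simp only [u]; ring
    rw [this, mul_inv_cancel₀ hx]
  have claim : ∀ M : ℕ, ∃ b : ℝ → EuclideanSpace ℝ (Fin n) → ℂ,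
      (∀ k ≥ (1:ℝ), ContDiff ℝ (⊤:ℕ∞) (b k)) ∧ (∀ k ≥ (1:ℝ), tsupport (b k) ⊆ S k) ∧
      NSym U S l (fun k _ => (l k ^ 2) ^ M) b ∧
      ∀ k ≥ (1:ℝ), k ^ M * ‖∫ x, Complex.exp (Complex.I * (k:ℂ) * Φ k x) * a k x‖
        = ‖∫ x, Complex.exp (Complex.I * (k:ℂ) * Φ k x) * b k x‖ := by
    intro M
    induction M with
    | zero =>
      refine ⟨a, fun k _ => ha_smooth k, fun k _ => subset_rfl,
        ⟨fun k _ => (ha_smooth k).contDiffOn, fun m => ?_⟩, fun k _ => by simp⟩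
      obtain ⟨D, hD⟩ := ha_sym m
      refine ⟨|D|, abs_nonneg _, fun k hk x _ => (hD k hk x).trans ?_⟩
      have hk0 : (0:ℝ) ≤ k := by linarith
      have h1 : k ^ ((m:ℝ)/3) ≤ l k ^ m := by
        show _ ≤ (k ^ δ) ^ m
        rw [← Real.rpow_natCast, ← Real.rpow_mul hk0]
        refine Real.rpow_le_rpow_of_exponent_le hk ?_
        have : (0:ℝ) ≤ m := Nat.cast_nonneg m
        nlinarith
      rw [pow_zero, mul_one]
      have h0 : 0 ≤ k ^ ((m:ℝ)/3) := by positivity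
      exact mul_le_mul (le_abs_self D) h1 h0 (abs_nonneg D)
    | succ M ih =>
      obtain ⟨b, hb1, hb2, hb3, hb4⟩ := ih
      have hvS : ∀ j, NSym U S l (fun k _ => l k * (l k ^ 2) ^ M) (fun k x => u j k x * b k x) :=
        fun j => NSym.mul hU hSU (huS j) hb3
      have hvt : ∀ j, ∀ k ≥ (1:ℝ), tsupport (fun x => u j k x * b k x) ⊆ S k := fun j k hk =>
        (tsupport_mul_subset_right).trans (hb2 k hk)
      have hv : ∀ j, ∀ k ≥ (1:ℝ), ContDiff ℝ (⊤:ℕ∞) (fun x => u j k x * b k x) := by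
        intro j k hk
        refine contDiff_iff_contDiffAt.2 fun x => ?_
        by_cases hx : x ∈ tsupport (fun x => u j k x * b k x)
        swap
        · exact contDiffAt_const.congr_of_eventuallyEq (notMem_tsupport_iff_eventuallyEq.1 hx)
        exact ((hvS j).smooth k hk).contDiffAt ((hU k hk).mem_nhds (hSU k hk (hvt j k hk hx)))
      have hvc : ∀ j, ∀ k ≥ (1:ℝ), HasCompactSupport (fun x => u j k x * b k x) := fun j k hk =>
        hX.of_isClosed_subset (isClosed_tsupport _) ((hvt j k hk).trans (hsupp k))
      refine ⟨fun k x => ∑ j, fderiv ℝ (fun x => u j k x * b k x) x (EuclideanSpace.single j 1),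
        fun k hk => ContDiff.sum fun j _ =>
          ((hv j k hk).fderiv_right (by norm_num)).clm_apply contDiff_const, ?_, ?_, ?_⟩
      · intro k hk
        refine closure_minimal (fun x hx => ?_) (isClosed_tsupport _)
        by_contra hcon
        refine hx (Finset.sum_eq_zero fun j _ => ?_)
        have h1 : x ∉ tsupport (fun x => u j k x * b k x) := fun h => hcon (hvt j k hk h)
        have h2 : fderiv ℝ (fun x => u j k x * b k x) x = 0 := by
          by_contra h3
          exact h1 (support_fderiv_subset ℝ h3)
        rw [h2]; rfl
      · refine (NSym.sum _ hU hSU fun j _ => NSym.deriv hU hSU (hvS j)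
          (EuclideanSpace.single j 1)).mono hl0 1 zero_le_one fun k _ x _ => ?_
        exact le_of_eq (by ring)
      · intro k hk
        have hk0 : (0:ℝ) ≤ k := by linarith
        have key := nsp_ibp (Φ k) (hΦ_smooth k) (Complex.I * (k:ℂ))
          (fun j x => u j k x * b k x) (fun j => hv j k hk) (fun j => hvc j k hk) (b k) (by
            intro x
            by_cases hx : x ∈ S k
            · have := hpu k x (hSU k hk hx)
              calc _ = (∑ j, p j k x * u j k x) * b k x := by
                    rw [Finset.sum_mul]
                    exact Finset.sum_congr rfl fun j _ => by simp only [p]; ring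
                _ = _ := by rw [this, one_mul]
            · have : b k x = 0 := image_eq_zero_of_notMem_tsupport fun h => hx (hb2 k hk h)
              simp [this])
        rw [key, norm_neg, norm_mul, ← hb4 k hk, norm_mul, Complex.norm_I, Complex.norm_real,
          Real.norm_of_nonneg hk0]
        ring
  obtain ⟨M, hM⟩ := exists_nat_ge ((N:ℝ) / (1 - 2 * δ))
  have hM' : (N:ℝ) ≤ M * (1 - 2 * δ) := (div_le_iff₀ (by linarith)).1 hM
  obtain ⟨b, hb1, hb2, hb3, hb4⟩ := claim M
  obtain ⟨D, hD0, hD⟩ := hb3.bound 0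
  refine ⟨D * (MeasureTheory.volume X).toReal, fun k hk => ?_⟩
  have hk0 : 0 < k := by linarith
  have hXint : ∀ c : EuclideanSpace ℝ (Fin n) → ℂ, tsupport c ⊆ X →
      ∫ x in X, Complex.exp (Complex.I * (k:ℂ) * Φ k x) * c x
        = ∫ x, Complex.exp (Complex.I * (k:ℂ) * Φ k x) * c x := by
    intro c hc
    refine MeasureTheory.setIntegral_eq_integral_of_forall_compl_eq_zero fun x hx => ?_
    rw [image_eq_zero_of_notMem_tsupport fun h => hx (hc h), mul_zero]
  have hbd : ‖∫ x in X, Complex.exp (Complex.I * (k:ℂ) * Φ k x) * b k x‖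
      ≤ (D * (l k ^ 2) ^ M) * (MeasureTheory.volume X).toReal := by
    refine MeasureTheory.norm_setIntegral_le_of_norm_le_const hX.measure_lt_top fun x _ => ?_
    have h1 : ‖Complex.exp (Complex.I * (k:ℂ) * Φ k x)‖ ≤ 1 := by
      rw [Complex.norm_exp, Real.exp_le_one_iff]
      have := hIm k hk x
      simp
      positivity
    have h2 : ‖b k x‖ ≤ D * (l k ^ 2) ^ M := by
      by_cases hx : x ∈ S k
      · have := hD k hk x hx
        rwa [norm_iteratedFDeriv_zero, pow_zero, mul_one] at this
      · rw [image_eq_zero_of_notMem_tsupport fun h => hx (hb2 k hk h), norm_zero]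
        have := hl0 k hk
        positivity
    rw [norm_mul]
    calc _ ≤ 1 * ‖b k x‖ := by gcongr
      _ ≤ _ := by rw [one_mul]; exact h2
  rw [hXint _ ((hb2 k hk).trans (hsupp k)), ← hb4 k hk] at hbd
  rw [hXint _ (hsupp k)]
  have hkM : (0:ℝ) < k ^ M := by positivity
  have hpow : (l k ^ 2) ^ M ≤ k ^ M * k ^ (-(N:ℝ)) := by
    show ((k ^ δ) ^ 2) ^ M ≤ _
    rw [← pow_mul, ← Real.rpow_natCast, ← Real.rpow_mul hk0.le, ← Real.rpow_natCast k M,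
      ← Real.rpow_add hk0]
    refine Real.rpow_le_rpow_of_exponent_le hk ?_
    push_cast
    linarith
  refine le_of_mul_le_mul_left ?_ hkM
  calc _ ≤ (D * (l k ^ 2) ^ M) * (MeasureTheory.volume X).toReal := hbd
    _ ≤ (D * (k ^ M * k ^ (-(N:ℝ)))) * (MeasureTheory.volume X).toReal := by gcongr
    _ = _ := by ring
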